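/- Let n ≥ 1 and let Ω ⊂ ℂⁿ be a smooth, bounded, pseudoconvex domain satisfying Catlin's Property (P). Then for every η with 0 < η < 1 there exist a smooth defining function ρ for Ω and an open neighborhood U of the closure of Ω such that ρ^{1/η} is strictly plurisubharmonic on U \ (closure of Ω). -/

import Mathlib

open Set

/-- The real Hessian quantity `Hu(z)(v) = D²u(z)(v,v) + D²u(z)(iv,iv)`, equal to four times
the complex Hessian of `u` at `z` applied to `v`. -/
noncomputable def reHess {n : ℕ} (u : EuclideanSpace ℂ (Fin n) → ℝ)
    (z v : EuclideanSpace ℂ (Fin n)) : ℝ :=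
  fderiv ℝ (fderiv ℝ u) z v v + fderiv ℝ (fderiv ℝ u) z (Complex.I • v) (Complex.I • v)

/-- `ρ` is a smooth defining function for the bounded open set `Ω`. -/
def IsDefiningFunction {n : ℕ} (Ω : Set (EuclideanSpace ℂ (Fin n)))
    (ρ : EuclideanSpace ℂ (Fin n) → ℝ) : Prop :=
  ContDiff ℝ (⊤ : ℕ∞) ρ ∧ Ω = {z | ρ z < 0} ∧ frontier Ω = {z | ρ z = 0} ∧
    ∀ z ∈ frontier Ω, fderiv ℝ ρ z ≠ 0

open Filter Topology

/-- The value at `v` of twice the `(1,0)`-differential of `u` at `z`. -/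
noncomputable def cDiff {n : ℕ} (u : EuclideanSpace ℂ (Fin n) → ℝ)
    (z v : EuclideanSpace ℂ (Fin n)) : ℂ :=
  ⟨fderiv ℝ u z v, -fderiv ℝ u z (Complex.I • v)⟩

section

variable {n : ℕ} {u f g : EuclideanSpace ℂ (Fin n) → ℝ} {z p v w : EuclideanSpace ℂ (Fin n)}

lemma ContDiffAt.eventually_norm_sub_lt {F : Type*} [NormedAddCommGroup F] [NormedSpace ℝ F]
    {G : EuclideanSpace ℂ (Fin n) → F} {k : WithTop ℕ∞} (h : ContDiffAt ℝ k G p) {ε : ℝ}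
    (hε : 0 < ε) : ∀ᶠ x in 𝓝 p, ‖G x - G p‖ < ε := by
  simpa only [dist_eq_norm] using Metric.continuousAt_iff'.1 h.continuousAt ε hε

lemma ContDiffAt.eventually_norm_lt {F : Type*} [NormedAddCommGroup F] [NormedSpace ℝ F]
    {G : EuclideanSpace ℂ (Fin n) → F} {k : WithTop ℕ∞} (h : ContDiffAt ℝ k G p) {B : ℝ}
    (hB : ‖G p‖ < B) : ∀ᶠ x in 𝓝 p, ‖G x‖ < B :=
  h.continuousAt.norm.eventually_lt_const hB

lemma norm_I_smul (v : EuclideanSpace ℂ (Fin n)) : ‖Complex.I • v‖ = ‖v‖ := by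
  simp [norm_smul]

lemma norm_cDiff_sq : ‖cDiff u z v‖ ^ 2 =
    fderiv ℝ u z v ^ 2 + fderiv ℝ u z (Complex.I • v) ^ 2 := by
  rw [← Complex.normSq_eq_norm_sq, Complex.normSq_apply]
  simp only [cDiff]
  ring

lemma cDiff_sub : cDiff u z (v - w) = cDiff u z v - cDiff u z w := by
  apply Complex.ext <;> simp [cDiff, smul_sub]
  ring

lemma complex_smul_eq (c : ℂ) (v : EuclideanSpace ℂ (Fin n)) :
    c • v = c.re • v + c.im • (Complex.I • v) := by
  conv_lhs => rw [← Complex.re_add_im c]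
  rw [add_smul, mul_smul, Complex.coe_smul, Complex.coe_smul]

lemma cDiff_smul (c : ℂ) : cDiff u z (c • v) = c * cDiff u z v := by
  have h : Complex.I • (c • v) = c.re • (Complex.I • v) - c.im • v := by
    rw [smul_smul, complex_smul_eq]
    simp
    abel
  apply Complex.ext
  · simp only [cDiff, Complex.mul_re]
    rw [complex_smul_eq]
    simp
  · simp only [cDiff, Complex.mul_im]
    rw [h]
    simp
    ring

lemma norm_cDiff_sub_le : ‖cDiff u z v - cDiff u p v‖ ≤
    2 * ‖fderiv ℝ u z - fderiv ℝ u p‖ * ‖v‖ := by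
  have h1 := (fderiv ℝ u z - fderiv ℝ u p).le_opNorm v
  have h2 := (fderiv ℝ u z - fderiv ℝ u p).le_opNorm (Complex.I • v)
  rw [norm_I_smul] at h2
  refine (Complex.norm_le_abs_re_add_abs_im _).trans ?_
  simp only [cDiff, Complex.sub_re, Complex.sub_im, _root_.sub_apply,
    Real.norm_eq_abs] at *
  rw [neg_sub_neg, abs_sub_comm (fderiv ℝ u p _)]
  linarith

lemma norm_cDiff_le : ‖cDiff u z v‖ ≤ 2 * ‖fderiv ℝ u z‖ * ‖v‖ := by
  have h1 := (fderiv ℝ u z).le_opNorm v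
  have h2 := (fderiv ℝ u z).le_opNorm (Complex.I • v)
  rw [norm_I_smul] at h2
  refine (Complex.norm_le_abs_re_add_abs_im _).trans ?_
  simp only [cDiff, Real.norm_eq_abs, abs_neg] at *
  linarith

lemma abs_reHess_sub_le : |reHess u z v - reHess u p v| ≤
    2 * ‖fderiv ℝ (fderiv ℝ u) z - fderiv ℝ (fderiv ℝ u) p‖ * ‖v‖ ^ 2 := by
  have h1 := (fderiv ℝ (fderiv ℝ u) z - fderiv ℝ (fderiv ℝ u) p).le_opNorm₂ v v
  have h2 := (fderiv ℝ (fderiv ℝ u) z - fderiv ℝ (fderiv ℝ u) p).le_opNorm₂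
    (Complex.I • v) (Complex.I • v)
  rw [norm_I_smul] at h2
  simp only [_root_.sub_apply, Real.norm_eq_abs] at h1 h2
  have h3 : reHess u z v - reHess u p v =
      (fderiv ℝ (fderiv ℝ u) z v v - fderiv ℝ (fderiv ℝ u) p v v) +
      (fderiv ℝ (fderiv ℝ u) z (Complex.I • v) (Complex.I • v) -
        fderiv ℝ (fderiv ℝ u) p (Complex.I • v) (Complex.I • v)) := by
    unfold reHess; ring
  rw [h3]
  refine (abs_add_le _ _).trans ?_
  linarith

/-- Continuity of the quadratic form `reHess u z` in the vector variable. -/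
lemma abs_reHess_sub_le_vec : |reHess u z v - reHess u z w| ≤
    2 * ‖fderiv ℝ (fderiv ℝ u) z‖ * ‖v - w‖ * (‖v‖ + ‖w‖) := by
  set B := fderiv ℝ (fderiv ℝ u) z with hB
  have key : ∀ x y : EuclideanSpace ℂ (Fin n),
      |B x x - B y y| ≤ ‖B‖ * ‖x - y‖ * (‖x‖ + ‖y‖) := by
    intro x y
    have h1 := B.le_opNorm₂ (x - y) x
    have h2 := B.le_opNorm₂ y (x - y)
    have h3 : B x x - B y y = B (x - y) x + B y (x - y) := by simp
    rw [h3]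
    refine (abs_add_le _ _).trans ?_
    simp only [Real.norm_eq_abs] at h1 h2
    linarith
  have h1 := key v w
  have h2 := key (Complex.I • v) (Complex.I • w)
  rw [← smul_sub, norm_I_smul, norm_I_smul, norm_I_smul] at h2
  have h3 : reHess u z v - reHess u z w = (B v v - B w w) +
      (B (Complex.I • v) (Complex.I • v) - B (Complex.I • w) (Complex.I • w)) := by
    simp only [reHess, ← hB]; ring
  rw [h3]
  refine (abs_add_le _ _).trans ?_
  linarith

lemma reHess_congr (h : f =ᶠ[𝓝 z] g) : reHess f z v = reHess g z v := by
  simp only [reHess, h.fderiv.fderiv_eq]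

lemma cDiff_add (hf : DifferentiableAt ℝ f z) (hg : DifferentiableAt ℝ g z) :
    cDiff (f + g) z v = cDiff f z v + cDiff g z v := by
  apply Complex.ext <;> simp [cDiff, fderiv_add hf hg]
  ring

lemma differentiableAt_fderiv (hf : ContDiffAt ℝ 2 f z) :
    DifferentiableAt ℝ (fderiv ℝ f) z :=
  (hf.fderiv_right (m := 1) (by norm_num)).differentiableAt (by norm_num)

lemma eventually_differentiableAt (hf : ContDiffAt ℝ 2 f z) :
    ∀ᶠ x in 𝓝 z, DifferentiableAt ℝ f x :=
  (hf.eventually (by simp)).mono fun _ hx => hx.differentiableAt (by norm_num)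

lemma reHess_add (hf : ContDiffAt ℝ 2 f z) (hg : ContDiffAt ℝ 2 g z) :
    reHess (f + g) z v = reHess f z v + reHess g z v := by
  have h : fderiv ℝ (f + g) =ᶠ[𝓝 z] fderiv ℝ f + fderiv ℝ g := by
    filter_upwards [eventually_differentiableAt hf, eventually_differentiableAt hg] with x hx hx'
    simp [fderiv_add hx hx']
  simp only [reHess, h.fderiv_eq,
    fderiv_add (differentiableAt_fderiv hf) (differentiableAt_fderiv hg)]
  simp
  ring

lemma cDiff_comp {φ : ℝ → ℝ} {a : ℝ} (hφ : HasDerivAt φ a (u z))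
    (hu : DifferentiableAt ℝ u z) : cDiff (φ ∘ u) z v = a * cDiff u z v := by
  apply Complex.ext <;> simp [cDiff, (hφ.comp_hasFDerivAt z hu.hasFDerivAt).fderiv]

lemma reHess_comp {φ φ' : ℝ → ℝ} {b : ℝ} (hφ : ∀ᶠ t in 𝓝 (u z), HasDerivAt φ (φ' t) t)
    (hφ' : HasDerivAt φ' b (u z)) (hu : ContDiffAt ℝ 2 u z) :
    reHess (φ ∘ u) z v = φ' (u z) * reHess u z v + b * ‖cDiff u z v‖ ^ 2 := by
  have h : fderiv ℝ (φ ∘ u) =ᶠ[𝓝 z] (φ' ∘ u) • fderiv ℝ u := by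
    filter_upwards [eventually_differentiableAt hu, hu.continuousAt.eventually hφ] with x hx hx'
    exact (hx'.comp_hasFDerivAt x hx.hasFDerivAt).fderiv
  have h2 := (hφ'.comp_hasFDerivAt z (hu.differentiableAt (by norm_num)).hasFDerivAt).smul
    (differentiableAt_fderiv hu).hasFDerivAt
  rw [norm_cDiff_sq]
  simp only [reHess, h.fderiv_eq, h2.fderiv]
  simp
  ring

/-- A function increasing at a definite rate in a direction `w` has a zero at distance comparable
to its value. -/
lemma exists_zero_of_le_fderiv (hu : Differentiable ℝ u) {ε : ℝ} {p₀ : EuclideanSpace ℂ (Fin n)}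
    (hw : ∀ x ∈ Metric.ball p₀ ε, 1 / 2 ≤ fderiv ℝ u x w) (hz : 0 < u z)
    (hε : dist z p₀ + 2 * u z * ‖w‖ < ε) :
    ∃ p ∈ Metric.ball p₀ ε, u p = 0 ∧ ‖z - p‖ ≤ 2 * u z * ‖w‖ := by
  have hd : ∀ t : ℝ, HasDerivAt (fun t : ℝ => u (z - t • w)) (-fderiv ℝ u (z - t • w) w) t := by
    intro t
    have h1 : HasDerivAt (fun t : ℝ => z - t • w) (-w) t := by
      simpa using ((hasDerivAt_id t).smul_const w).const_sub z
    have h2 := (hu (z - t • w)).hasFDerivAt.comp_hasDerivAt t h1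
    rw [map_neg] at h2
    exact h2
  have hnorm : ∀ t ∈ Icc (0 : ℝ) (2 * u z), ‖z - (z - t • w)‖ ≤ 2 * u z * ‖w‖ := by
    intro t ht
    rw [sub_sub_cancel, norm_smul, Real.norm_of_nonneg ht.1]
    exact mul_le_mul_of_nonneg_right ht.2 (norm_nonneg _)
  have hmem : ∀ t ∈ Icc (0 : ℝ) (2 * u z), z - t • w ∈ Metric.ball p₀ ε := by
    intro t ht
    have h1 := hnorm t ht
    rw [← dist_eq_norm, dist_comm] at h1
    rw [Metric.mem_ball]
    linarith [dist_triangle (z - t • w) z p₀]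
  have hcont : ContinuousOn (fun t : ℝ => u (z - t • w)) (Icc 0 (2 * u z)) :=
    fun t _ => (hd t).continuousAt.continuousWithinAt
  have h0 : (0 : ℝ) ≤ 2 * u z := by positivity
  have hle := (convex_Icc (0 : ℝ) (2 * u z)).image_sub_le_mul_sub_of_deriv_le hcont
    (fun t _ => (hd t).differentiableAt.differentiableWithinAt) (C := -(1 / 2))
    (fun t ht => by
      rw [(hd t).deriv]
      linarith [hw _ (hmem t (interior_subset ht))])
    0 (left_mem_Icc.2 h0) (2 * u z) (right_mem_Icc.2 h0) h0
  simp only [zero_smul, sub_zero] at hle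
  obtain ⟨t, ht, ht0⟩ := intermediate_value_Icc' h0 hcont
    (show (0 : ℝ) ∈ Icc _ _ from ⟨by linarith, by simpa using hz.le⟩)
  exact ⟨z - t • w, hmem t ht, ht0, hnorm t ht⟩

/-- If the Hessian is nonnegative on complex tangential vectors, then on a general vector its
negative part is controlled by the complex normal component. -/
lemma neg_le_reHess_of_tangential {B : ℝ} (hB : 0 ≤ B) (hw : ‖w‖ ≤ B)
    (hpw : 1 / 2 ≤ fderiv ℝ u p w) (h1 : ‖fderiv ℝ u p‖ ≤ B)
    (h2 : ‖fderiv ℝ (fderiv ℝ u) p‖ ≤ B)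
    (hpsc : ∀ v : EuclideanSpace ℂ (Fin n),
      fderiv ℝ u p v = 0 → fderiv ℝ u p (Complex.I • v) = 0 → 0 ≤ reHess u p v)
    (v : EuclideanSpace ℂ (Fin n)) :
    -(4 * B ^ 2 * (2 + 4 * B ^ 2) * ‖cDiff u p v‖ * ‖v‖) ≤ reHess u p v := by
  have hLw : 1 / 2 ≤ ‖cDiff u p w‖ := hpw.trans ((le_abs_self _).trans
    (Complex.abs_re_le_norm (cDiff u p w)))
  have hLw0 : cDiff u p w ≠ 0 := by
    intro h
    rw [h, norm_zero] at hLw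
    norm_num at hLw
  set c := cDiff u p v / cDiff u p w with hc
  have hzero : cDiff u p (v - c • w) = 0 := by
    rw [cDiff_sub, cDiff_smul, hc, div_mul_cancel₀ _ hLw0, sub_self]
  have hpos : 0 ≤ reHess u p (v - c • w) :=
    hpsc _ (by simpa [cDiff] using congrArg Complex.re hzero)
      (by simpa [cDiff] using congrArg Complex.im hzero)
  set q := ‖cDiff u p v‖ with hq
  have hq0 : 0 ≤ q := norm_nonneg _
  have hcn : ‖c‖ ≤ 2 * q := by
    rw [hc, norm_div, div_le_iff₀ (by linarith)]
    nlinarith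
  have hcw : ‖c • w‖ ≤ 2 * q * B := by
    rw [norm_smul]
    exact mul_le_mul hcn hw (norm_nonneg _) (by positivity)
  have hqv : q ≤ 2 * B * ‖v‖ := norm_cDiff_le.trans (by gcongr)
  have hv' : ‖v - c • w‖ ≤ ‖v‖ + 4 * B ^ 2 * ‖v‖ := by
    refine (norm_sub_le _ _).trans ?_
    nlinarith
  have h3 := abs_reHess_sub_le_vec (u := u) (z := p) (v := v) (w := v - c • w)
  rw [sub_sub_cancel] at h3
  have h4 : 2 * ‖fderiv ℝ (fderiv ℝ u) p‖ * ‖c • w‖ * (‖v‖ + ‖v - c • w‖) ≤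
      2 * B * (2 * q * B) * (‖v‖ + (‖v‖ + 4 * B ^ 2 * ‖v‖)) := by gcongr
  have h5 := (abs_le.1 (h3.trans h4)).1
  linarith

/-- Near a boundary point of a pseudoconvex domain, on the exterior side, the Hessian of a
defining function is bounded below by its value and the complex normal component. -/
lemma exists_eventually_reHess_ge (hu : ContDiff ℝ (⊤ : ℕ∞) u) {p₀ : EuclideanSpace ℂ (Fin n)}
    (hp₀ : u p₀ = 0) (hne : fderiv ℝ u p₀ ≠ 0)
    (hpsc : ∀ p, u p = 0 → ∀ v : EuclideanSpace ℂ (Fin n),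
      fderiv ℝ u p v = 0 → fderiv ℝ u p (Complex.I • v) = 0 → 0 ≤ reHess u p v) :
    ∃ C : ℝ, ∀ᶠ z in 𝓝 p₀, 0 < u z → ∀ v : EuclideanSpace ℂ (Fin n),
      -(C * (u z * ‖v‖ ^ 2 + ‖cDiff u z v‖ * ‖v‖)) ≤ reHess u z v := by
  obtain ⟨w, hw⟩ : ∃ w, fderiv ℝ u p₀ w = 1 := by
    obtain ⟨x, hx⟩ : ∃ x, fderiv ℝ u p₀ x ≠ 0 := by
      by_contra! h
      exact hne (ContinuousLinearMap.ext h)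
    exact ⟨(fderiv ℝ u p₀ x)⁻¹ • x, by simp [hx]⟩
  have hD1 : ContDiff ℝ (⊤ : ℕ∞) (fderiv ℝ u) := hu.fderiv_right (by norm_cast)
  have hD2 : ContDiff ℝ (⊤ : ℕ∞) (fderiv ℝ (fderiv ℝ u)) := hD1.fderiv_right (by norm_cast)
  have h1top : (1 : WithTop ℕ∞) ≤ ((⊤ : ℕ∞) : WithTop ℕ∞) := by exact_mod_cast le_top
  obtain ⟨K1, t1, ht1, hK1⟩ := (hD1.of_le h1top).contDiffAt (x := p₀) |>.exists_lipschitzOnWith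
  obtain ⟨K2, t2, ht2, hK2⟩ := (hD2.of_le h1top).contDiffAt (x := p₀) |>.exists_lipschitzOnWith
  obtain ⟨B, hB0, hBK1, hBK2, hBw, hBD1, hBD2⟩ : ∃ B : ℝ, 0 ≤ B ∧ K1 ≤ B ∧ K2 ≤ B ∧ ‖w‖ ≤ B ∧
      ‖fderiv ℝ u p₀‖ < B ∧ ‖fderiv ℝ (fderiv ℝ u) p₀‖ < B :=
    ⟨K1 + K2 + ‖w‖ + ‖fderiv ℝ u p₀‖ + ‖fderiv ℝ (fderiv ℝ u) p₀‖ + 1, by positivity, by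
      have := K2.2; have := norm_nonneg w; have := norm_nonneg (fderiv ℝ u p₀)
      have := norm_nonneg (fderiv ℝ (fderiv ℝ u) p₀); have := K1.2
      simp only [NNReal.val_eq_coe] at *
      refine ⟨?_, ?_, ?_, ?_, ?_⟩ <;> linarith⟩
  have hE : ∀ᶠ x in 𝓝 p₀, x ∈ t1 ∧ x ∈ t2 ∧ 1 / 2 < fderiv ℝ u x w ∧ ‖fderiv ℝ u x‖ < B ∧
      ‖fderiv ℝ (fderiv ℝ u) x‖ < B := by
    have hcw : Continuous fun x => fderiv ℝ u x w := hD1.continuous.clm_apply continuous_const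
    have hhalf : 1 / 2 < fderiv ℝ u p₀ w := by rw [hw]; norm_num
    filter_upwards [ht1, ht2, hcw.continuousAt.eventually_const_lt hhalf,
      hD1.contDiffAt.eventually_norm_lt hBD1, hD2.contDiffAt.eventually_norm_lt hBD2]
      with x a b c d e
    exact ⟨a, b, c, d, e⟩
  obtain ⟨ε, hε, hball⟩ := Metric.eventually_nhds_iff_ball.1 hE
  have hsmall : ∀ᶠ z in 𝓝 p₀, dist z p₀ + 2 * u z * ‖w‖ < ε := by
    have hc : Continuous fun z => dist z p₀ + 2 * u z * ‖w‖ := by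
      have := hu.continuous
      fun_prop
    exact hc.continuousAt.eventually_lt_const (by simpa [hp₀] using hε)
  refine ⟨4 * B ^ 2 * (2 + 4 * B ^ 2) * (1 + 4 * B ^ 2) + 4 * B ^ 2, ?_⟩
  filter_upwards [hsmall, Metric.ball_mem_nhds p₀ hε] with z hz hzb hpos v
  obtain ⟨p, hpb, hp, hzp⟩ := exists_zero_of_le_fderiv
    (hu.differentiable (by simp)) (fun x hx => (hball x hx).2.2.1.le) hpos hz
  obtain ⟨hpt1, hpt2, hpw, hpD1, hpD2⟩ := hball p hpb
  obtain ⟨hzt1, hzt2, -, -, -⟩ := hball z hzb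
  have hdist : ‖z - p‖ ≤ 2 * B * u z := hzp.trans (by nlinarith)
  have hl1 : ‖fderiv ℝ u p - fderiv ℝ u z‖ ≤ B * (2 * B * u z) := by
    rw [norm_sub_rev]
    refine (hK1.norm_sub_le hzt1 hpt1).trans ?_
    gcongr
  have hl2 : ‖fderiv ℝ (fderiv ℝ u) z - fderiv ℝ (fderiv ℝ u) p‖ ≤ B * (2 * B * u z) := by
    refine (hK2.norm_sub_le hzt2 hpt2).trans ?_
    gcongr
  have hHp := neg_le_reHess_of_tangential hB0 hBw hpw.le hpD1.le hpD2.le (hpsc p hp) v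
  have hH : -(2 * (B * (2 * B * u z)) * ‖v‖ ^ 2) ≤ reHess u z v - reHess u p v :=
    (abs_le.1 (abs_reHess_sub_le.trans (by gcongr))).1
  have hL : ‖cDiff u p v‖ ≤ ‖cDiff u z v‖ + 2 * (B * (2 * B * u z)) * ‖v‖ := by
    have h1 := norm_cDiff_sub_le (u := u) (z := p) (p := z) (v := v)
    have h2 : 2 * ‖fderiv ℝ u p - fderiv ℝ u z‖ * ‖v‖ ≤ 2 * (B * (2 * B * u z)) * ‖v‖ := by
      gcongr
    linarith [norm_sub_norm_le (cDiff u p v) (cDiff u z v)]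
  have h6 : 4 * B ^ 2 * (2 + 4 * B ^ 2) * ‖cDiff u p v‖ * ‖v‖ ≤ 4 * B ^ 2 * (2 + 4 * B ^ 2) *
      (‖cDiff u z v‖ + 2 * (B * (2 * B * u z)) * ‖v‖) * ‖v‖ := by gcongr
  have h7 : 0 ≤ 4 * B ^ 2 * (2 + 4 * B ^ 2) * (4 * B ^ 2) * (‖cDiff u z v‖ * ‖v‖) := by positivity
  have h8 : 0 ≤ 4 * B ^ 2 * (‖cDiff u z v‖ * ‖v‖) := by positivity
  have h9 : 0 ≤ 4 * B ^ 2 * (2 + 4 * B ^ 2) * (u z * ‖v‖ ^ 2) := by positivity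
  linarith

lemma exists_eventually_nhdsSet_reHess_ge (hu : ContDiff ℝ (⊤ : ℕ∞) u)
    {K : Set (EuclideanSpace ℂ (Fin n))} (hK : IsCompact K) (hK0 : ∀ p ∈ K, u p = 0)
    (hne : ∀ p ∈ K, fderiv ℝ u p ≠ 0)
    (hpsc : ∀ p, u p = 0 → ∀ v : EuclideanSpace ℂ (Fin n),
      fderiv ℝ u p v = 0 → fderiv ℝ u p (Complex.I • v) = 0 → 0 ≤ reHess u p v) :
    ∃ C : ℝ, 0 < C ∧ ∀ᶠ z in 𝓝ˢ K, 0 < u z → ∀ v : EuclideanSpace ℂ (Fin n),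
      -(C * (u z * ‖v‖ ^ 2 + ‖cDiff u z v‖ * ‖v‖)) ≤ reHess u z v := by
  have hmono : ∀ {C C' : ℝ} {z : EuclideanSpace ℂ (Fin n)}, C ≤ C' →
      (0 < u z → ∀ v : EuclideanSpace ℂ (Fin n),
        -(C * (u z * ‖v‖ ^ 2 + ‖cDiff u z v‖ * ‖v‖)) ≤ reHess u z v) →
      (0 < u z → ∀ v : EuclideanSpace ℂ (Fin n),
        -(C' * (u z * ‖v‖ ^ 2 + ‖cDiff u z v‖ * ‖v‖)) ≤ reHess u z v) := by
    intro C C' z hCC' h hz v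
    have h1 : 0 ≤ u z * ‖v‖ ^ 2 + ‖cDiff u z v‖ * ‖v‖ := by positivity
    linarith [h hz v, mul_le_mul_of_nonneg_right hCC' h1]
  refine hK.induction_on ⟨1, one_pos, by simp⟩ ?_ ?_ ?_
  · rintro S T hST ⟨C, hC, h⟩
    exact ⟨C, hC, h.filter_mono (nhdsSet_mono hST)⟩
  · rintro S T ⟨C, hC, h⟩ ⟨C', hC', h'⟩
    refine ⟨max C C', lt_max_of_lt_left hC, ?_⟩
    rw [nhdsSet_union, eventually_sup]
    exact ⟨h.mono fun _ => hmono (le_max_left _ _), h'.mono fun _ => hmono (le_max_right _ _)⟩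
  · intro p hp
    obtain ⟨C, hC⟩ := exists_eventually_reHess_ge hu (hK0 p hp) (hne p hp) hpsc
    obtain ⟨V, hV, hVo, hpV⟩ := eventually_nhds_iff.1 hC
    refine ⟨V, mem_nhdsWithin_of_mem_nhds (hVo.mem_nhds hpV), max C 1,
      lt_max_of_lt_right one_pos, ?_⟩
    exact eventually_nhdsSet_iff_exists.2
      ⟨V, hVo, subset_rfl, fun z hz => hmono (le_max_left _ _) (hV z hz)⟩

lemma mul_add_sq_le_of_le_add {C N α y β δ : ℝ} (hδ : 0 < δ) (hα : 0 ≤ α) (h : α ≤ y + β) :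
    C * N * α + α ^ 2 ≤
      C ^ 2 / (4 * δ) * N ^ 2 + (1 + δ) ^ 2 * y ^ 2 + (1 + δ) * (1 + 1 / δ) * β ^ 2 := by
  have h1 : C * N * α ≤ C ^ 2 / (4 * δ) * N ^ 2 + δ * α ^ 2 := by
    have : C ^ 2 / (4 * δ) * N ^ 2 + δ * α ^ 2 - C * N * α =
        (C * N - 2 * δ * α) ^ 2 / (4 * δ) := by
      field_simp; ring
    have h2 : 0 ≤ (C * N - 2 * δ * α) ^ 2 / (4 * δ) := by positivity
    linarith
  have h2 : α ^ 2 ≤ (1 + δ) * y ^ 2 + (1 + 1 / δ) * β ^ 2 := by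
    have h3 : α ^ 2 ≤ (y + β) ^ 2 := by gcongr
    have h4 : (1 + δ) * y ^ 2 + (1 + 1 / δ) * β ^ 2 - (y + β) ^ 2 = (δ * y - β) ^ 2 / δ := by
      field_simp; ring
    have h5 : 0 ≤ (δ * y - β) ^ 2 / δ := by positivity
    linarith
  nlinarith

/-- The weight `exp (c * exp μ)` makes the power `(1 + δ) ^ 2` of a pseudoconvex defining function
strictly plurisubharmonic at exterior points where the Hessian of `μ` is large. -/
lemma reHess_rpow_pos {μ : EuclideanSpace ℂ (Fin n) → ℝ} {C δ c m : ℝ}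
    (hu : ContDiffAt ℝ 2 u z) (hz : 0 < u z) (hμ : ContDiffAt ℝ 2 μ z)
    (hμ0 : 0 ≤ μ z) (hμ1 : μ z ≤ 1) (hδ : 0 < δ) (hc : 0 < c)
    (hcK : c * ((1 + δ) * (1 + 1 / δ)) * Real.exp 1 ≤ 1)
    (hH : -(C * (u z * ‖v‖ ^ 2 + ‖cDiff u z v‖ * ‖v‖)) ≤ reHess u z v)
    (hm0 : 0 ≤ m) (hm : C + C ^ 2 / (4 * δ) < c * m)
    (hμH : m * ‖v‖ ^ 2 ≤ reHess μ z v) (hv : v ≠ 0) :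
    0 < reHess (fun w => (u w * Real.exp (c * Real.exp (μ w))) ^ ((1 + δ) ^ 2)) z v := by
  set s : ℝ := (1 + δ) ^ 2 with hs
  have hs0 : 0 < s := by positivity
  set φ : EuclideanSpace ℂ (Fin n) → ℝ := (fun t => c * Real.exp t) ∘ μ with hφ
  set ψ : EuclideanSpace ℂ (Fin n) → ℝ := Real.log ∘ u + φ with hψ
  have hexp : ∀ t, HasDerivAt (fun t => c * Real.exp t) (c * Real.exp t) t :=
    fun t => (Real.hasDerivAt_exp t).const_mul c
  have hlogd : ContDiffAt ℝ 2 (Real.log ∘ u) z := hu.log hz.ne'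
  have hφd : ContDiffAt ℝ 2 φ z := contDiffAt_const.mul hμ.exp
  have heq : (fun w => (u w * Real.exp (c * Real.exp (μ w))) ^ s) =ᶠ[𝓝 z]
      (fun t => Real.exp (s * t)) ∘ ψ := by
    filter_upwards [hu.continuousAt.eventually_const_lt hz] with x hx
    simp only [hψ, hφ, Function.comp_apply, Pi.add_apply]
    rw [Real.rpow_def_of_pos (by positivity), Real.log_mul hx.ne' (Real.exp_ne_zero _),
      Real.log_exp, mul_comm]
  have hse : ∀ a t : ℝ, HasDerivAt (fun t => a * Real.exp (s * t)) (a * s * Real.exp (s * t)) t := by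
    intro a t
    have h := (((hasDerivAt_id t).const_mul s).exp).const_mul a
    simp only [id, mul_one] at h
    exact h.congr_deriv (by ring)
  rw [reHess_congr heq, reHess_comp (φ' := fun t => s * Real.exp (s * t))
    (Eventually.of_forall fun t => by simpa using hse 1 t) (hse s (ψ z)) (hlogd.add hφd),
    hψ, reHess_add hlogd hφd,
    cDiff_add (hlogd.differentiableAt (by norm_num)) (hφd.differentiableAt (by norm_num)), ← hψ,
    reHess_comp (φ' := fun t => t⁻¹) (b := -(u z ^ 2)⁻¹)
      ((eventually_ne_nhds hz.ne').mono fun t ht => Real.hasDerivAt_log ht)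
      (hasDerivAt_inv hz.ne') hu,
    hφ, reHess_comp (Eventually.of_forall hexp) (hexp _) hμ, ← hφ]
  have hLu := cDiff_comp (v := v) (Real.hasDerivAt_log hz.ne') (hu.differentiableAt (by norm_num))
  have hLφ : cDiff φ z v = _ :=
    cDiff_comp (v := v) (hexp (μ z)) (hμ.differentiableAt (by norm_num))
  set α := ‖cDiff (Real.log ∘ u) z v‖ with hα
  set β := ‖cDiff φ z v‖ with hβ
  set y := ‖cDiff (Real.log ∘ u) z v + cDiff φ z v‖ with hy
  have hαe : α = (u z)⁻¹ * ‖cDiff u z v‖ := by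
    rw [hα, hLu, norm_mul, Complex.norm_real, Real.norm_of_nonneg (by positivity)]
  have hβe : β = c * Real.exp (μ z) * ‖cDiff μ z v‖ := by
    rw [hβ, hLφ, norm_mul, Complex.norm_real, Real.norm_of_nonneg (by positivity)]
  have htri : α ≤ y + β := by
    have h := norm_sub_le (cDiff (Real.log ∘ u) z v + cDiff φ z v) (cDiff φ z v)
    rwa [add_sub_cancel_right] at h
  have hmain := mul_add_sq_le_of_le_add (C := C) (N := ‖v‖) hδ (norm_nonneg _) htri
  have hHu : -(C * ‖v‖ ^ 2) - C * ‖v‖ * α ≤ (u z)⁻¹ * reHess u z v := by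
    have h := mul_le_mul_of_nonneg_left hH (inv_nonneg.2 hz.le)
    refine le_trans (le_of_eq ?_) h
    rw [hαe]
    field_simp
    ring
  have hα2 : (u z ^ 2)⁻¹ * ‖cDiff u z v‖ ^ 2 = α ^ 2 := by
    rw [hαe]; field_simp
  have hKβ : (1 + δ) * (1 + 1 / δ) * β ^ 2 ≤ c * Real.exp (μ z) * ‖cDiff μ z v‖ ^ 2 := by
    have h1 : c * ((1 + δ) * (1 + 1 / δ)) * Real.exp (μ z) ≤ 1 := by
      refine le_trans ?_ hcK
      gcongr
    have h2 : 0 ≤ c * Real.exp (μ z) * ‖cDiff μ z v‖ ^ 2 := by positivity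
    rw [hβe]
    nlinarith [mul_le_mul_of_nonneg_right h1 h2]
  have hcH : c * m * ‖v‖ ^ 2 ≤ c * Real.exp (μ z) * reHess μ z v := by
    have h1 : 1 ≤ Real.exp (μ z) := Real.one_le_exp hμ0
    have h2 : 0 ≤ m * ‖v‖ ^ 2 := by positivity
    calc c * m * ‖v‖ ^ 2 = c * 1 * (m * ‖v‖ ^ 2) := by ring
      _ ≤ c * Real.exp (μ z) * reHess μ z v := by gcongr
  have hN : (C + C ^ 2 / (4 * δ)) * ‖v‖ ^ 2 < c * m * ‖v‖ ^ 2 :=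
    mul_lt_mul_of_pos_right hm (by positivity)
  have hX : 0 < (u z)⁻¹ * reHess u z v - (u z ^ 2)⁻¹ * ‖cDiff u z v‖ ^ 2 +
      (c * Real.exp (μ z) * reHess μ z v + c * Real.exp (μ z) * ‖cDiff μ z v‖ ^ 2) +
      s * y ^ 2 := by
    rw [hα2]
    linarith
  have hpos : 0 < s * Real.exp (s * ψ z) := by positivity
  refine lt_of_lt_of_eq (mul_pos hpos hX) ?_
  ring

lemma eventually_reHess_ge_half {lam : EuclideanSpace ℂ (Fin n) → ℝ} {M : ℝ} (hM : 0 < M)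
    (hlam : ContDiffAt ℝ 3 lam p)
    (h : ∀ v : EuclideanSpace ℂ (Fin n), 4 * M * ‖v‖ ^ 2 ≤ reHess lam p v) :
    ∀ᶠ z in 𝓝 p, ∀ v : EuclideanSpace ℂ (Fin n), 2 * M * ‖v‖ ^ 2 ≤ reHess lam z v := by
  have hc : ContDiffAt ℝ 1 (fderiv ℝ (fderiv ℝ lam)) p :=
    (hlam.fderiv_right (m := 2) (by norm_num)).fderiv_right (by norm_num)
  filter_upwards [hc.eventually_norm_sub_lt hM] with z hz v
  have h1 := (abs_le.1 (abs_reHess_sub_le (u := lam) (z := z) (p := p) (v := v))).1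
  have h2 := mul_le_mul_of_nonneg_right hz.le (sq_nonneg ‖v‖)
  linarith [h v]

lemma exists_contDiff_eventuallyEq {K U : Set (EuclideanSpace ℂ (Fin n))}
    {lam : EuclideanSpace ℂ (Fin n) → ℝ} (hK : IsClosed K) (hU : IsOpen U) (hKU : K ⊆ U)
    (hlam : ContDiffOn ℝ (⊤ : ℕ∞) lam U) :
    ∃ μ : EuclideanSpace ℂ (Fin n) → ℝ, ContDiff ℝ (⊤ : ℕ∞) μ ∧ ∀ᶠ z in 𝓝ˢ K, μ z = lam z := by
  obtain ⟨χ, h0, h1, -⟩ := exists_contMDiffMap_zero_one_nhds_of_isClosed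
    (modelWithCornersSelf ℝ (EuclideanSpace ℂ (Fin n))) (n := (⊤ : ℕ∞)) hU.isClosed_compl hK
    (disjoint_compl_left_iff_subset.2 hKU)
  have hχ : ContDiff ℝ (⊤ : ℕ∞) χ := χ.contMDiff.contDiff
  refine ⟨fun z => χ z * lam z, contDiff_iff_contDiffAt.2 fun z => ?_, ?_⟩
  · by_cases hz : z ∈ U
    · exact hχ.contDiffAt.mul (hlam.contDiffAt (hU.mem_nhds hz))
    · have h2 : ∀ᶠ x in 𝓝 z, χ x = 0 := h0.filter_mono (nhds_le_nhdsSet hz)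
      refine (contDiffAt_const (c := (0 : ℝ))).congr_of_eventuallyEq ?_
      filter_upwards [h2] with x hx
      simp [hx]
  · filter_upwards [h1] with x hx
    simp [hx]

lemma IsDefiningFunction.mul_exp {Ω : Set (EuclideanSpace ℂ (Fin n))}
    (hf : IsDefiningFunction Ω f) (hg : ContDiff ℝ (⊤ : ℕ∞) g) :
    IsDefiningFunction Ω fun z => f z * Real.exp (g z) := by
  obtain ⟨hs, hΩ, hfr, hd⟩ := hf
  refine ⟨hs.mul hg.exp, ?_, ?_, ?_⟩
  · rw [hΩ]
    ext z
    simp [mul_neg_iff, Real.exp_pos, (Real.exp_pos _).le, not_lt.2]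
  · rw [hfr]
    ext z
    simp
  · intro z hz h
    have hz0 : f z = 0 := by simpa [hfr] using hz
    have hfz : DifferentiableAt ℝ f z := hs.differentiable (by simp) z
    have hgz : DifferentiableAt ℝ g z := hg.differentiable (by simp) z
    rw [fderiv_fun_mul hfz hgz.exp, hz0, zero_smul, zero_add, smul_eq_zero] at h
    exact h.elim (Real.exp_ne_zero _) (hd z hz)

end

theorem stein_neighborhood_exponent_of_property_P
    (n : ℕ) (hn : 1 ≤ n)
    (Ω : Set (EuclideanSpace ℂ (Fin n)))
    (hΩ_open : IsOpen Ω) (hΩ_bdd : Bornology.IsBounded Ω)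
    (ρ₀ : EuclideanSpace ℂ (Fin n) → ℝ)
    (hρ₀ : IsDefiningFunction Ω ρ₀)
    -- pseudoconvexity
    (hpsc : ∀ p ∈ frontier Ω, ∀ v : EuclideanSpace ℂ (Fin n),
      fderiv ℝ ρ₀ p v = 0 → fderiv ℝ ρ₀ p (Complex.I • v) = 0 → 0 ≤ reHess ρ₀ p v)
    -- Catlin's Property (P)
    (hP : ∀ M : ℝ, 0 < M → ∃ (U : Set (EuclideanSpace ℂ (Fin n)))
      (lam : EuclideanSpace ℂ (Fin n) → ℝ),
      IsOpen U ∧ closure Ω ⊆ U ∧ ContDiffOn ℝ (⊤ : ℕ∞) lam U ∧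
      (∀ z ∈ U, 0 ≤ lam z ∧ lam z ≤ 1) ∧
      (∀ z ∈ U, ∀ v : EuclideanSpace ℂ (Fin n), 0 ≤ reHess lam z v) ∧
      (∀ p ∈ frontier Ω, ∀ v : EuclideanSpace ℂ (Fin n),
        4 * M * ‖v‖ ^ 2 ≤ reHess lam p v)) :
    ∀ η : ℝ, 0 < η → η < 1 →
      ∃ (ρ : EuclideanSpace ℂ (Fin n) → ℝ) (U : Set (EuclideanSpace ℂ (Fin n))),
        IsDefiningFunction Ω ρ ∧ IsOpen U ∧ closure Ω ⊆ U ∧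
        ∀ z ∈ U \ closure Ω, ∀ v : EuclideanSpace ℂ (Fin n), v ≠ 0 →
          0 < reHess (fun w => (ρ w) ^ (1 / η)) z v := by
  intro η hη0 hη1
  obtain ⟨hsm, hΩ, hfr, hd⟩ := id hρ₀
  have hfr0 : ∀ p ∈ frontier Ω, ρ₀ p = 0 := fun p hp => by simpa [hfr] using hp
  have hcpt : IsCompact (frontier Ω) :=
    hΩ_bdd.isCompact_closure.of_isClosed_subset isClosed_frontier frontier_subset_closure
  obtain ⟨C, hC, hHess⟩ := exists_eventually_nhdsSet_reHess_ge hsm hcpt hfr0 hd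
    (fun p hp => hpsc p (by rw [hfr]; exact hp))
  obtain ⟨δ, hδ, hδη⟩ : ∃ δ : ℝ, 0 < δ ∧ (1 + δ) ^ 2 = 1 / η := by
    have h1 : 1 < 1 / η := (one_lt_div hη0).2 hη1
    refine ⟨√(1 / η) - 1, sub_pos.2 (Real.lt_sqrt_of_sq_lt (by simpa using h1)), ?_⟩
    rw [add_sub_cancel, Real.sq_sqrt (by positivity)]
  set c : ℝ := 1 / ((1 + δ) * (1 + 1 / δ) * Real.exp 1) with hc
  have hc0 : 0 < c := by positivity
  have hcK : c * ((1 + δ) * (1 + 1 / δ)) * Real.exp 1 ≤ 1 := by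
    rw [mul_assoc, hc, one_div_mul_cancel (by positivity)]
  set M : ℝ := (C + C ^ 2 / (4 * δ)) / c with hM
  have hM0 : 0 < M := by positivity
  have hcM : C + C ^ 2 / (4 * δ) < c * (2 * M) := by
    have h1 : c * M = C + C ^ 2 / (4 * δ) := mul_div_cancel₀ _ hc0.ne'
    have h2 : 0 < c * M := by positivity
    linarith
  obtain ⟨U, lam, hU, hΩU, hlam, hlam01, -, hlamP⟩ := hP M hM0
  obtain ⟨μ, hμ, hμlam⟩ := exists_contDiff_eventuallyEq isClosed_closure hU hΩU hlam
  have h2top : (2 : WithTop ℕ∞) ≤ ((⊤ : ℕ∞) : WithTop ℕ∞) :=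
    WithTop.coe_le_coe.2 (le_top : (2 : ℕ∞) ≤ ⊤)
  have h3top : (3 : WithTop ℕ∞) ≤ ((⊤ : ℕ∞) : WithTop ℕ∞) :=
    WithTop.coe_le_coe.2 (le_top : (3 : ℕ∞) ≤ ⊤)
  have hloc : ∀ p ∈ frontier Ω, ∀ᶠ z in 𝓝 p, μ z ∈ Icc (0 : ℝ) 1 ∧
      ∀ v : EuclideanSpace ℂ (Fin n), 2 * M * ‖v‖ ^ 2 ≤ reHess μ z v := by
    intro p hp
    have hpΩ := frontier_subset_closure hp
    have heq : μ =ᶠ[𝓝 p] lam := hμlam.filter_mono (nhds_le_nhdsSet hpΩ)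
    filter_upwards [heq, hU.mem_nhds (hΩU hpΩ), eventually_reHess_ge_half hM0
      ((hμ.of_le h3top).contDiffAt) fun v => by rw [reHess_congr heq]; exact hlamP p hp v]
      with z hz hzU hzH
    exact ⟨hz ▸ hlam01 z hzU, hzH⟩
  obtain ⟨V, hV, hfrV, hVH⟩ := eventually_nhdsSet_iff_exists.1
    (hHess.and (eventually_nhdsSet_iff_forall.2 hloc))
  refine ⟨fun z => ρ₀ z * Real.exp (c * Real.exp (μ z)), Ω ∪ V,
    hρ₀.mul_exp (contDiff_const.mul hμ.exp), hΩ_open.union hV, ?_, ?_⟩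
  · rw [closure_eq_self_union_frontier]
    exact union_subset_union_right _ hfrV
  · rintro z ⟨hzU, hzΩ⟩ v hv
    have hzV : z ∈ V := hzU.resolve_left fun h => hzΩ (subset_closure h)
    have hz0 : 0 < ρ₀ z := by
      have h1 : ¬ ρ₀ z < 0 := fun h => hzΩ (subset_closure (by rw [hΩ]; exact h))
      have h2 : ρ₀ z ≠ 0 := fun h => hzΩ (frontier_subset_closure (by rw [hfr]; exact h))
      exact lt_of_le_of_ne (not_lt.1 h1) h2.symm
    obtain ⟨hzH, ⟨hμ0, hμ1⟩, hμH⟩ := hVH z hzV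
    rw [← hδη]
    exact reHess_rpow_pos (hsm.of_le h2top).contDiffAt hz0 (hμ.of_le h2top).contDiffAt hμ0 hμ1
      hδ hc0 hcK (hzH hz0 v) (by positivity) hcM (hμH v) hv
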